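/- Let w ∈ ℝ^n have all entries strictly positive, b ∈ ℝ, σ : ℝ → ℝ continuous satisfying the STFE property with σ(b) = 0, and f(x) = σ(wᵀx + b) on [0,1]^n. Then for every x ∈ [0,1]^n, either g(x) = f(x), or the function g is linear (affine) on the segment [0, x] (i.e., g(λx) = λ·g(x) for all λ ∈ [0,1]). -/

import Mathlib

noncomputable section

/-- `φ` is the concave envelope of `f` over `S`: the pointwise smallest concave
function on `S` that majorizes `f` on `S`. -/
def IsConcaveEnvelope {E : Type*} [AddCommMonoid E] [Module ℝ E]
    (S : Set E) (f φ : E → ℝ) : Prop :=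
  ConcaveOn ℝ S φ ∧ (∀ x ∈ S, f x ≤ φ x) ∧
    ∀ h : E → ℝ, ConcaveOn ℝ S h → (∀ x ∈ S, f x ≤ h x) → ∀ x ∈ S, φ x ≤ h x

/-- `φ` is the convex envelope of `f` over `S`: the pointwise largest convex
function on `S` that minorizes `f` on `S`. -/
def IsConvexEnvelope {E : Type*} [AddCommMonoid E] [Module ℝ E]
    (S : Set E) (f φ : E → ℝ) : Prop :=
  ConvexOn ℝ S φ ∧ (∀ x ∈ S, φ x ≤ f x) ∧
    ∀ h : E → ℝ, ConvexOn ℝ S h → (∀ x ∈ S, h x ≤ f x) → ∀ x ∈ S, h x ≤ φ x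

/-- `zhat ∈ [ℓ,u]` witnesses the secant-then-function form of the concave
envelope of `σ` on `[ℓ,u]`. -/
def STFEwitness (σ : ℝ → ℝ) (ℓ u zhat : ℝ) : Prop :=
  zhat ∈ Set.Icc ℓ u ∧
    IsConcaveEnvelope (Set.Icc ℓ u) σ
      (fun z => if z < zhat then σ ℓ + (σ zhat - σ ℓ) / (zhat - ℓ) * (z - ℓ) else σ z)

/-- The secant-then-function envelope (STFE) property. -/
def STFE (σ : ℝ → ℝ) : Prop :=
  ∀ ℓ u : ℝ, ℓ ≤ u → ∃ zhat, STFEwitness σ ℓ u zhat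

/-- The tie point of `σ` over `[ℓ,u]`: the smallest STFE witness. -/
def IsTiePoint (σ : ℝ → ℝ) (ℓ u zhat : ℝ) : Prop :=
  STFEwitness σ ℓ u zhat ∧ ∀ z, STFEwitness σ ℓ u z → zhat ≤ z

/-- `σ` is S-shaped: convex then concave. -/
def SShaped (σ : ℝ → ℝ) : Prop :=
  ∃ zt : ℝ, ConvexOn ℝ (Set.Iic zt) σ ∧ ConcaveOn ℝ (Set.Ici zt) σ

/-- The dot product `wᵀx`. -/
def dotp {n : ℕ} (w x : Fin n → ℝ) : ℝ := ∑ i, w i * x i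

/-- The region `R_f` of `[0,1]^n`. Note `‖x‖` is the sup norm on `Fin n → ℝ`. -/
def Rf {n : ℕ} (w : Fin n → ℝ) (b zhat : ℝ) : Set (Fin n → ℝ) :=
  {x | x ∈ Set.Icc (0 : Fin n → ℝ) 1 ∧ zhat ≤ dotp w x + b}

/-- The region `R_l` of `[0,1]^n`. -/
def Rl {n : ℕ} (w : Fin n → ℝ) (b zhat : ℝ) : Set (Fin n → ℝ) :=
  {x | x ∈ Set.Icc (0 : Fin n → ℝ) 1 ∧ dotp w x + b < zhat ∧
    zhat * ‖x‖ ≤ dotp w x + b * ‖x‖}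

/-- The region `R_i` of `[0,1]^n`. -/
def Ri {n : ℕ} (w : Fin n → ℝ) (b zhat : ℝ) (i : Fin n) : Set (Fin n → ℝ) :=
  {x | x ∈ Set.Icc (0 : Fin n → ℝ) 1 ∧ dotp w x + b * ‖x‖ < zhat * ‖x‖ ∧
    (∀ j, j < i → x j < x i) ∧ (∀ j, i ≤ j → x j ≤ x i)}

/-- `D'` is a face of the convex set `D`. -/
def IsFace {E : Type*} [AddCommGroup E] [Module ℝ E] (D D' : Set E) : Prop :=
  D' ⊆ D ∧ Convex ℝ D' ∧
    ∀ x ∈ D, ∀ y ∈ D, ∀ t : ℝ, 0 < t → t < 1 →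
      (1 - t) • x + t • y ∈ D' → x ∈ D' ∧ y ∈ D'


theorem dotp_smul {n : ℕ} (w x : Fin n → ℝ) (c : ℝ) : dotp w (c • x) = c * dotp w x := by
  simp only [dotp, Pi.smul_apply, smul_eq_mul, Finset.mul_sum]
  exact Finset.sum_congr rfl fun i _ => by ring

theorem dotp_nonneg {n : ℕ} {w x : Fin n → ℝ} (hw : ∀ i, 0 < w i) (hx : 0 ≤ x) :
    0 ≤ dotp w x :=
  Finset.sum_nonneg fun i _ => mul_nonneg (hw i).le (hx i)

theorem smul_mem_unitCube {n : ℕ} {x : Fin n → ℝ} (hx : x ∈ Set.Icc (0 : Fin n → ℝ) 1)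
    {c : ℝ} (hc0 : 0 ≤ c) (hc1 : c ≤ 1) : c • x ∈ Set.Icc (0 : Fin n → ℝ) 1 :=
  ⟨fun i => mul_nonneg hc0 (hx.1 i), fun i => mul_le_one₀ hc1 (hx.1 i) (hx.2 i)⟩

theorem smul_mem_Rl {n : ℕ} {w x : Fin n → ℝ} (hw : ∀ i, 0 < w i) {b zhat : ℝ}
    (hx : x ∈ Rl w b zhat) {c : ℝ} (hc0 : 0 < c) (hc1 : c ≤ 1) : c • x ∈ Rl w b zhat := by
  obtain ⟨hcube, hlt, hle⟩ := hx
  refine ⟨smul_mem_unitCube hcube hc0.le hc1, ?_, ?_⟩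
  · rw [dotp_smul]
    linarith [mul_le_of_le_one_left (dotp_nonneg hw hcube.1) hc1]
  · rw [dotp_smul, norm_smul, Real.norm_of_nonneg hc0.le]
    linarith [mul_le_mul_of_nonneg_left hle hc0.le]

theorem smul_mem_Ri {n : ℕ} {w x : Fin n → ℝ} {b zhat : ℝ} {i : Fin n}
    (hx : x ∈ Ri w b zhat i) {c : ℝ} (hc0 : 0 < c) (hc1 : c ≤ 1) : c • x ∈ Ri w b zhat i := by
  obtain ⟨hcube, hlt, hbefore, hafter⟩ := hx
  refine ⟨smul_mem_unitCube hcube hc0.le hc1, ?_,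
    fun j hj => mul_lt_mul_of_pos_left (hbefore j hj) hc0,
    fun j hj => mul_le_mul_of_nonneg_left (hafter j hj) hc0.le⟩
  rw [dotp_smul, norm_smul, Real.norm_of_nonneg hc0.le]
  linarith [mul_lt_mul_of_pos_left hlt hc0]

/-- Every vector has a first index at which its maximum is attained. -/
theorem exists_first_argmax {n : ℕ} (x : Fin (n + 1) → ℝ) :
    ∃ i, (∀ j, j < i → x j < x i) ∧ ∀ j, i ≤ j → x j ≤ x i := by
  obtain ⟨m, hm⟩ := Finite.exists_max x
  obtain ⟨i, hi, hmin⟩ :=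
    wellFounded_lt.has_min {i : Fin (n + 1) | ∀ j, x j ≤ x i} ⟨m, hm⟩
  refine ⟨i, fun j hj => ?_, fun j _ => hi j⟩
  by_contra! h
  exact hmin j (fun k => (hi k).trans h) hj

/-- The regions `Rf`, `Rl` and `Ri` cover the unit cube. -/
theorem mem_Rf_or_mem_Rl_or_mem_Ri {n : ℕ} (w : Fin (n + 1) → ℝ) (b zhat : ℝ)
    {x : Fin (n + 1) → ℝ} (hx : x ∈ Set.Icc (0 : Fin (n + 1) → ℝ) 1) :
    x ∈ Rf w b zhat ∨ x ∈ Rl w b zhat ∨ ∃ i, x ∈ Ri w b zhat i := by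
  rcases le_or_gt zhat (dotp w x + b) with h | h
  · exact Or.inl ⟨hx, h⟩
  rcases le_or_gt (zhat * ‖x‖) (dotp w x + b * ‖x‖) with h' | h'
  · exact Or.inr (Or.inl ⟨hx, h, h'⟩)
  · obtain ⟨i, hi⟩ := exists_first_argmax x
    exact Or.inr (Or.inr ⟨i, hx, h', hi⟩)

theorem stmt14 {n : ℕ} (w : Fin (n+1) → ℝ) (hw : ∀ i, 0 < w i) (b : ℝ)
    (σ : ℝ → ℝ) (hσ : Continuous σ) (hSTFE : STFE σ) (hb : σ b = 0)
    (zhat : ℝ) (htie : IsTiePoint σ b ((∑ i, w i) + b) zhat)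
    (ψ : Fin (n+1) → (Fin n → ℝ) → ℝ)
    (hψ : ∀ i, IsConcaveEnvelope (Set.Icc 0 1)
      (fun y : Fin n → ℝ => σ ((∑ j, w (i.succAbove j) * y j) + w i + b)) (ψ i))
    (g : (Fin (n+1) → ℝ) → ℝ)
    (hgf : ∀ x ∈ Rf w b zhat, g x = σ (dotp w x + b))
    (hgl : ∀ x ∈ Rl w b zhat, g x = σ zhat / (zhat - b) * dotp w x)
    (hgi : ∀ i : Fin (n+1), ∀ x ∈ Ri w b zhat i,
      g x = x i * ψ i (fun j => x (i.succAbove j) / x i)) :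
    ∀ x ∈ Set.Icc (0 : Fin (n+1) → ℝ) 1,
      g x = σ (dotp w x + b) ∨ ∀ lam ∈ Set.Icc (0 : ℝ) 1, g (lam • x) = lam * g x := by
  intro x hx
  have hcube0 : (0 : Fin (n + 1) → ℝ) ∈ Set.Icc (0 : Fin (n + 1) → ℝ) 1 :=
    ⟨le_rfl, zero_le_one⟩
  have hdot0 : dotp w 0 = 0 := by simp [dotp]
  have hg0 : g 0 = 0 := by
    rcases le_or_gt zhat b with h | h
    · rw [hgf 0 ⟨hcube0, by rwa [hdot0, zero_add]⟩, hdot0, zero_add, hb]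
    · rw [hgl 0 ⟨hcube0, by rwa [hdot0, zero_add], by simp [hdot0]⟩, hdot0, mul_zero]
  rcases mem_Rf_or_mem_Rl_or_mem_Ri w b zhat hx with hf | hl | ⟨i, hi⟩
  · exact Or.inl (hgf x hf)
  all_goals
    refine Or.inr fun c hc => ?_
    rcases hc.1.eq_or_lt with rfl | hc0
    · rw [zero_smul, hg0, zero_mul]
  · rw [hgl _ (smul_mem_Rl hw hl hc0 hc.2), hgl x hl, dotp_smul]
    ring
  · rw [hgi i _ (smul_mem_Ri hi hc0 hc.2), hgi i x hi]
    simp only [Pi.smul_apply, smul_eq_mul, mul_div_mul_left _ _ hc0.ne', mul_assoc]
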